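/- Cancellation property of the special entropy pair (Lemma 4.1): Let γ > 1, θ = (γ−1)/2, and 𝔟 = (3−γ)/(2(γ−1)) > −1/2. Define for ρ ≥ 0 and u ∈ ℝ: η#(ρ,u) = ½ ρ ∫_{−1}^1 (u + ρ^θ s) |u + ρ^θ s| (1 − s²)^𝔟 ds and q#(ρ,u) = ½ ρ ∫_{−1}^1 (u + θρ^θ s)(u + ρ^θ s) |u + ρ^θ s| (1 − s²)^𝔟 ds. Then q#(ρ,u) − u η#(ρ,u) = ½ θ ρ^{1+θ} ∫_{−1}^1 s (u + ρ^θ s) |u + ρ^θ s| (1 − s²)^𝔟 ds, and there exists a constant C_γ > 0, depending only on γ, such that for all ρ ≥ 0 and u ∈ ℝ: |q#(ρ,u) − u η#(ρ,u)| ≤ C_γ (ρ^γ |u| + ρ^{γ+θ}). -/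

import Mathlib

open Real MeasureTheory Set

/-- The weight `(1 - s²)ᵇ` is integrable on `[-1, 1]` as soon as `b > -1`. -/
theorem intervalIntegrable_one_sub_sq_rpow {b : ℝ} (hb : -1 < b) :
    IntervalIntegrable (fun s : ℝ => (1 - s ^ 2) ^ b) volume (-1) 1 := by
  have right_half : IntervalIntegrable (fun s : ℝ => (1 - s ^ 2) ^ b) volume 0 1 := by
    have h₁ : IntervalIntegrable (fun s : ℝ => (1 - s) ^ b) volume 0 1 := by
      have h := (intervalIntegral.intervalIntegrable_rpow' (a := 1) (b := 0) hb).comp_sub_left 1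
      simpa using h
    have h₂ : ContinuousOn (fun s : ℝ => (1 + s) ^ b) (uIcc 0 1) := by
      refine ContinuousOn.rpow_const (by fun_prop) fun s hs => Or.inl ?_
      rw [uIcc_of_le zero_le_one] at hs
      linarith [hs.1]
    refine (h₁.mul_continuousOn h₂).congr fun s hs => ?_
    rw [uIoc_of_le zero_le_one] at hs
    rw [← mul_rpow (by linarith [hs.2]) (by linarith [hs.1])]
    ring_nf
  have left_half : IntervalIntegrable (fun s : ℝ => (1 - s ^ 2) ^ b) volume (-1) 0 := by
    have h := (IntervalIntegrable.iff_comp_neg (f := fun s : ℝ => (1 - s ^ 2) ^ b)).mp right_half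
    simpa using h.symm
  exact left_half.trans right_half

/-- The integral of an odd function over a symmetric interval vanishes. -/
theorem intervalIntegral_eq_zero_of_odd {f : ℝ → ℝ} (hf : ∀ s, f (-s) = -f s) (a : ℝ) :
    ∫ s in -a..a, f s = 0 := by
  have h := intervalIntegral.integral_comp_neg (a := -a) (b := a) f
  simp only [hf, intervalIntegral.integral_neg, neg_neg] at h
  linarith

/-- Local Lipschitz estimate for the signed square `x ↦ x |x|`. -/
theorem abs_mul_abs_sub_mul_abs_le (x y : ℝ) :
    abs (x * |x| - y * |y|) ≤ |x - y| * (|x| + |y|) := by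
  rw [abs_le]
  rcases abs_cases x with ⟨hx, _⟩ | ⟨hx, _⟩ <;> rcases abs_cases y with ⟨hy, _⟩ | ⟨hy, _⟩ <;>
    rcases abs_cases (x - y) with ⟨hxy, _⟩ | ⟨hxy, _⟩ <;> rw [hx, hy, hxy] <;>
    constructor <;> nlinarith

/-- The weighted first moment of the signed square of `u + r s` grows only linearly in `u`,
because the quadratic contribution `u |u|` is cancelled by symmetry. -/
theorem abs_integral_signed_sq_moment_le {b : ℝ} (hb : -1 < b) {r : ℝ} (hr : 0 ≤ r) (u : ℝ) :
    |∫ s in (-1:ℝ)..1, s * (u + r * s) * |u + r * s| * (1 - s ^ 2) ^ b|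
      ≤ r * (2 * |u| + r) * ∫ s in (-1:ℝ)..1, (1 - s ^ 2) ^ b := by
  have hw := intervalIntegrable_one_sub_sq_rpow hb
  have hf : IntervalIntegrable
      (fun s : ℝ => s * (u + r * s) * |u + r * s| * (1 - s ^ 2) ^ b) volume (-1) 1 :=
    hw.continuousOn_mul (by fun_prop)
  have hf₀ : IntervalIntegrable
      (fun s : ℝ => s * (u * |u|) * (1 - s ^ 2) ^ b) volume (-1) 1 :=
    hw.continuousOn_mul (by fun_prop)
  have hzero : ∫ s in (-1:ℝ)..1, s * (u * |u|) * (1 - s ^ 2) ^ b = 0 :=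
    intervalIntegral_eq_zero_of_odd (fun s => by simp only [neg_sq]; ring) 1
  rw [← sub_zero (∫ s in (-1:ℝ)..1, s * (u + r * s) * |u + r * s| * (1 - s ^ 2) ^ b), ← hzero,
    ← intervalIntegral.integral_sub hf hf₀, ← intervalIntegral.integral_const_mul,
    ← Real.norm_eq_abs]
  refine intervalIntegral.norm_integral_le_of_norm_le (by norm_num)
    (Filter.Eventually.of_forall fun s hs => ?_) (hw.const_mul _)
  have hs₁ : |s| ≤ 1 := abs_le.mpr ⟨hs.1.le, hs.2⟩
  have hweight : 0 ≤ (1 - s ^ 2) ^ b :=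
    rpow_nonneg (by nlinarith [hs.1, hs.2]) _
  have hrs : |r * s| ≤ r := by
    rw [abs_mul, abs_of_nonneg hr]
    exact mul_le_of_le_one_right hr hs₁
  have hsum : |u + r * s| + |u| ≤ 2 * |u| + r := by
    linarith [abs_add_le u (r * s)]
  have hdiff : abs ((u + r * s) * |u + r * s| - u * |u|) ≤ r * (2 * |u| + r) := by
    refine (abs_mul_abs_sub_mul_abs_le _ _).trans ?_
    rw [add_sub_cancel_left]
    exact mul_le_mul hrs hsum (by positivity) hr
  rw [Real.norm_eq_abs, show s * (u + r * s) * |u + r * s| * (1 - s ^ 2) ^ b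
      - s * (u * |u|) * (1 - s ^ 2) ^ b
      = s * ((u + r * s) * |u + r * s| - u * |u|) * (1 - s ^ 2) ^ b by ring,
    abs_mul, abs_mul, abs_of_nonneg hweight]
  refine mul_le_mul_of_nonneg_right ?_ hweight
  exact (mul_le_of_le_one_left (abs_nonneg _) hs₁).trans hdiff

/-- Cancellation property of the special entropy pair (Lemma 4.1):
q# - u η# = ½ θ ρ^{1+θ} ∫ s (u + ρ^θ s)|u + ρ^θ s|(1-s²)^𝔟 ds, and
|q# - u η#| ≤ C_γ (ρ^γ |u| + ρ^{γ+θ}), with θ = (γ-1)/2 and 𝔟 = (3-γ)/(2(γ-1)). -/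
theorem special_entropy_cancellation (γ : ℝ) (hγ : 1 < γ) :
    (∀ ρ u : ℝ, 0 ≤ ρ →
      (1/2 * ρ * ∫ s in (-1:ℝ)..1,
          (u + (γ - 1)/2 * ρ ^ ((γ - 1)/2) * s) * (u + ρ ^ ((γ - 1)/2) * s)
            * |u + ρ ^ ((γ - 1)/2) * s| * (1 - s^2) ^ ((3 - γ)/(2*(γ - 1))))
        - u * (1/2 * ρ * ∫ s in (-1:ℝ)..1,
            (u + ρ ^ ((γ - 1)/2) * s) * |u + ρ ^ ((γ - 1)/2) * s|
              * (1 - s^2) ^ ((3 - γ)/(2*(γ - 1))))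
      = 1/2 * ((γ - 1)/2) * ρ ^ (1 + (γ - 1)/2) * ∫ s in (-1:ℝ)..1,
          s * (u + ρ ^ ((γ - 1)/2) * s) * |u + ρ ^ ((γ - 1)/2) * s|
            * (1 - s^2) ^ ((3 - γ)/(2*(γ - 1)))) ∧
    (∃ Cγ : ℝ, 0 < Cγ ∧ ∀ ρ u : ℝ, 0 ≤ ρ →
      abs ((1/2 * ρ * ∫ s in (-1:ℝ)..1,
          (u + (γ - 1)/2 * ρ ^ ((γ - 1)/2) * s) * (u + ρ ^ ((γ - 1)/2) * s)
            * |u + ρ ^ ((γ - 1)/2) * s| * (1 - s^2) ^ ((3 - γ)/(2*(γ - 1))))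
        - u * (1/2 * ρ * ∫ s in (-1:ℝ)..1,
            (u + ρ ^ ((γ - 1)/2) * s) * |u + ρ ^ ((γ - 1)/2) * s|
              * (1 - s^2) ^ ((3 - γ)/(2*(γ - 1)))))
        ≤ Cγ * (ρ ^ γ * |u| + ρ ^ (γ + (γ - 1)/2))) := by
  have hb : -1 < (3 - γ) / (2 * (γ - 1)) := by
    rw [lt_div_iff₀ (by linarith)]
    linarith
  have identity : ∀ ρ u : ℝ, 0 ≤ ρ →
      (1/2 * ρ * ∫ s in (-1:ℝ)..1,
          (u + (γ - 1)/2 * ρ ^ ((γ - 1)/2) * s) * (u + ρ ^ ((γ - 1)/2) * s)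
            * |u + ρ ^ ((γ - 1)/2) * s| * (1 - s^2) ^ ((3 - γ)/(2*(γ - 1))))
        - u * (1/2 * ρ * ∫ s in (-1:ℝ)..1,
            (u + ρ ^ ((γ - 1)/2) * s) * |u + ρ ^ ((γ - 1)/2) * s|
              * (1 - s^2) ^ ((3 - γ)/(2*(γ - 1))))
      = 1/2 * ((γ - 1)/2) * ρ ^ (1 + (γ - 1)/2) * ∫ s in (-1:ℝ)..1,
          s * (u + ρ ^ ((γ - 1)/2) * s) * |u + ρ ^ ((γ - 1)/2) * s|
            * (1 - s^2) ^ ((3 - γ)/(2*(γ - 1))) := by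
    intro ρ u hρ
    rw [rpow_add_of_nonneg hρ zero_le_one (by linarith), rpow_one]
    generalize ρ ^ ((γ - 1)/2) = r
    have hw := intervalIntegrable_one_sub_sq_rpow hb
    generalize (3 - γ)/(2*(γ - 1)) = b at hw ⊢
    have hmoment : IntervalIntegrable
        (fun s : ℝ => s * (u + r * s) * |u + r * s| * (1 - s ^ 2) ^ b) volume (-1) 1 :=
      hw.continuousOn_mul (by fun_prop)
    have hmean : IntervalIntegrable
        (fun s : ℝ => (u + r * s) * |u + r * s| * (1 - s ^ 2) ^ b) volume (-1) 1 :=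
      hw.continuousOn_mul (by fun_prop)
    have hsplit : ∫ s in (-1:ℝ)..1, (u + (γ - 1)/2 * r * s) * (u + r * s)
          * |u + r * s| * (1 - s^2) ^ b
        = u * (∫ s in (-1:ℝ)..1, (u + r * s) * |u + r * s| * (1 - s ^ 2) ^ b)
          + (γ - 1)/2 * r
            * ∫ s in (-1:ℝ)..1, s * (u + r * s) * |u + r * s| * (1 - s ^ 2) ^ b := by
      rw [← intervalIntegral.integral_const_mul, ← intervalIntegral.integral_const_mul,
        ← intervalIntegral.integral_add (hmean.const_mul _) (hmoment.const_mul _)]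
      exact intervalIntegral.integral_congr fun s _ => by ring
    rw [hsplit]
    ring
  refine ⟨identity, ?_⟩
  set W := ∫ s in (-1:ℝ)..1, (1 - s ^ 2) ^ ((3 - γ)/(2*(γ - 1))) with hW
  have hW₀ : 0 ≤ W := intervalIntegral.integral_nonneg (by norm_num) fun s hs =>
    rpow_nonneg (by nlinarith [hs.1, hs.2]) _
  have hθ : 0 < (γ - 1) / 2 := by linarith
  refine ⟨(γ - 1) / 2 * (W + 1), by positivity, fun ρ u hρ => ?_⟩
  rw [identity ρ u hρ]
  have hr : 0 ≤ ρ ^ ((γ - 1)/2) := rpow_nonneg hρ _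
  have hbound := abs_integral_signed_sq_moment_le hb hr u
  rw [← hW] at hbound
  have hpow : ρ ^ γ = ρ ^ (1 + (γ - 1)/2) * ρ ^ ((γ - 1)/2) := by
    rw [← rpow_add_of_nonneg hρ (by linarith) hθ.le]
    ring_nf
  rw [rpow_add_of_nonneg hρ (zero_le_one.trans hγ.le) hθ.le, hpow]
  have hp : 0 ≤ ρ ^ (1 + (γ - 1)/2) := rpow_nonneg hρ _
  generalize ρ ^ (1 + (γ - 1)/2) = p at *
  generalize ρ ^ ((γ - 1)/2) = r at *
  rw [abs_mul, abs_of_nonneg (by positivity : 0 ≤ 1/2 * ((γ - 1)/2) * p)]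
  calc _ ≤ 1/2 * ((γ - 1)/2) * p * (r * (2 * |u| + r) * W) := by gcongr
    _ ≤ 1/2 * ((γ - 1)/2) * p * (r * (2 * |u| + 2 * r) * (W + 1)) := by
        gcongr <;> linarith
    _ = _ := by ring
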